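/- Let d ∈ ℕ, m ∈ {0,1,2,3}, c ∈ [1,∞), and let p¹,…,p^d be probability kernels on [0,1] such that for every k ∈ {1,…,d}, every m' ∈ {0,…,m}, and every φ ∈ C^{m'}([0,1],ℝ) the function z ↦ ∫ φ(y) p^k(z,dy) belongs to C^{m'}([0,1],ℝ) and satisfies ‖z ↦ ∫ φ(y) p^k(z,dy)‖_{C^{m'}} ≤ c ‖φ‖_{C^{m'}}. Then for every f ∈ C^m([0,1]^d,ℝ) and every i ∈ {1,…,d} the m-th partial derivative in the i-th coordinate, [0,1]^d ∋ x ↦ (∂^m/∂x_i^m) ∫ f(y) ⊗_{k=1}^d p^k(x_k,dy_k), where the integral is with respect to the product measure ⊗_{k=1}^d p^k(x_k,·), exists and is continuous on [0,1]^d. -/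

import Mathlib

open MeasureTheory Filter

noncomputable section

/-- The unit cube `[0,1]^d` in `ℝ^d`. -/
def cube (d : ℕ) : Set (Fin d → ℝ) := Set.univ.pi fun _ => Set.Icc (0:ℝ) 1

/-- Partial derivative in coordinate `i` (within `[0,1]`, i.e. one-sided at the boundary). -/
def pd (d : ℕ) (i : Fin d) (g : (Fin d → ℝ) → ℝ) : (Fin d → ℝ) → ℝ :=
  fun x => derivWithin (fun t => g (Function.update x i t)) (Set.Icc (0:ℝ) 1) (x i)

/-- Iterated partial derivative `∂^α` (coordinates applied in a fixed order). -/
def mderiv (d : ℕ) (α : Fin d → ℕ) (f : (Fin d → ℝ) → ℝ) : (Fin d → ℝ) → ℝ :=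
  List.foldr (fun i g => (pd d i)^[α i] g) f (List.finRange d)

/-- `f ∈ C^m([0,1]^d, ℝ)`: all partial derivatives of order `0` through `m` exist
(one-sidedly at the boundary) and are continuous on the cube. -/
def MemCm (d : ℕ) : ℕ → ((Fin d → ℝ) → ℝ) → Prop
  | 0, f => ContinuousOn f (cube d)
  | m + 1, f => ContinuousOn f (cube d) ∧ ∀ i : Fin d,
      (∀ x ∈ cube d, DifferentiableWithinAt ℝ (fun t => f (Function.update x i t))
        (Set.Icc (0:ℝ) 1) (x i)) ∧
      MemCm d m (pd d i f)

/-- Sup norm over the cube: `‖g‖_∞ = sup_{x ∈ [0,1]^d} |g(x)|`. -/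
def supCube (d : ℕ) (g : (Fin d → ℝ) → ℝ) : ℝ := ⨆ x : cube d, |g x.1|

/-- The `C^m`-norm: `max_{|α| ≤ m} sup_{x ∈ [0,1]^d} |∂^α f(x)|`. -/
def CmNorm (d m : ℕ) (f : (Fin d → ℝ) → ℝ) : ℝ :=
  ⨆ α : {α : Fin d → ℕ // (∑ i, α i) ≤ m}, supCube d (mderiv d α.1 f)

/-- `λ_m := max_{0 < |α| ≤ m} ∑_i ‖∂^α b_i‖_∞`. -/
def lamNorm (d m : ℕ) (b : Fin d → (Fin d → ℝ) → ℝ) : ℝ :=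
  ⨆ α : {α : Fin d → ℕ // 0 < (∑ i, α i) ∧ (∑ i, α i) ≤ m},
    ∑ i, supCube d (mderiv d α.1 (b i))

/-- One-sided derivative within `[0,1]` for a one-dimensional function. -/
noncomputable def dI (φ : ℝ → ℝ) : ℝ → ℝ := fun z => derivWithin φ (Set.Icc (0:ℝ) 1) z

/-- `φ ∈ C^m([0,1], ℝ)`: derivatives of order `0` through `m` exist
(one-sidedly at the boundary) and are continuous on `[0,1]`. -/
def MemC1d : ℕ → (ℝ → ℝ) → Prop
  | 0, φ => ContinuousOn φ (Set.Icc (0:ℝ) 1)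
  | m + 1, φ => ContinuousOn φ (Set.Icc (0:ℝ) 1) ∧
      (∀ z ∈ Set.Icc (0:ℝ) 1, DifferentiableWithinAt ℝ φ (Set.Icc (0:ℝ) 1) z) ∧
      MemC1d m (dI φ)

/-- The `C^m`-norm of a one-dimensional function: `max_{k ≤ m} sup_{z ∈ [0,1]} |φ^{(k)}(z)|`. -/
noncomputable def C1dNorm (m : ℕ) (φ : ℝ → ℝ) : ℝ :=
  ⨆ k : Fin (m + 1), ⨆ z : Set.Icc (0:ℝ) 1, |dI^[(k : ℕ)] φ z.1|

/-- `PEC d [i₁, …, i_n] g` means: the successive partial derivatives of `g` in the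
coordinates `i₁, …, i_n` (in this order, one-sided at the boundary) exist at every point
of the cube, and the final `n`-th order partial derivative is continuous on the cube. -/
def PEC (d : ℕ) : List (Fin d) → ((Fin d → ℝ) → ℝ) → Prop
  | [], g => ContinuousOn g (cube d)
  | i :: L, g => (∀ x ∈ cube d, DifferentiableWithinAt ℝ
      (fun t => g (Function.update x i t)) (Set.Icc (0:ℝ) 1) (x i)) ∧
      PEC d L (pd d i g)
open Function in
lemma update_mem_cube {d : ℕ} {x : Fin d → ℝ} (hx : x ∈ cube d) (i : Fin d) {t : ℝ}
    (ht : t ∈ Set.Icc (0:ℝ) 1) : update x i t ∈ cube d := by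
  intro k _
  rcases eq_or_ne k i with rfl | hk
  · simpa using ht
  · simpa [hk] using hx k trivial

lemma isCompact_cube (d : ℕ) : IsCompact (cube d) :=
  isCompact_univ_pi fun _ => isCompact_Icc

/-- The retraction of `ℝ` onto `[0,1]`. -/
def clamp (t : ℝ) : ℝ := Set.projIcc (0:ℝ) 1 zero_le_one t

lemma clamp_mem (t : ℝ) : clamp t ∈ Set.Icc (0:ℝ) 1 := Subtype.coe_prop _

lemma clamp_of_mem {t : ℝ} (ht : t ∈ Set.Icc (0:ℝ) 1) : clamp t = t := by
  simp [clamp, Set.projIcc_of_mem zero_le_one ht]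

lemma continuous_clamp : Continuous clamp :=
  continuous_subtype_val.comp continuous_projIcc

/-- The retraction of `ℝ^d` onto the unit cube. -/
def cubeClamp (d : ℕ) (y : Fin d → ℝ) : Fin d → ℝ := fun k => clamp (y k)

lemma cubeClamp_mem {d : ℕ} (y : Fin d → ℝ) : cubeClamp d y ∈ cube d :=
  fun k _ => clamp_mem (y k)

lemma cubeClamp_of_mem {d : ℕ} {y : Fin d → ℝ} (hy : y ∈ cube d) : cubeClamp d y = y :=
  funext fun k => clamp_of_mem (hy k trivial)

lemma continuous_cubeClamp (d : ℕ) : Continuous (cubeClamp d) :=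
  continuous_pi fun k => continuous_clamp.comp (continuous_apply k)

lemma cubeClamp_update {d : ℕ} (y : Fin d → ℝ) (i : Fin d) (s : ℝ) :
    cubeClamp d (Function.update y i s) = Function.update (cubeClamp d y) i (clamp s) := by
  funext k
  rcases eq_or_ne k i with rfl | hk
  · simp [cubeClamp]
  · simp [cubeClamp, hk]

/-! ### Calculus of `C^m` functions on the interval -/

lemma MemC1d.continuousOn {m : ℕ} {φ : ℝ → ℝ} (h : MemC1d m φ) :
    ContinuousOn φ (Set.Icc (0:ℝ) 1) := by
  cases m with
  | zero => exact h
  | succ m => exact h.1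

lemma MemC1d.continuousOn_iterate {m : ℕ} {φ : ℝ → ℝ} (h : MemC1d m φ) {j : ℕ} (hj : j ≤ m) :
    ContinuousOn (dI^[j] φ) (Set.Icc (0:ℝ) 1) := by
  induction j generalizing m φ with
  | zero => exact h.continuousOn
  | succ j ih =>
    obtain ⟨m, rfl⟩ : ∃ n, m = n + 1 := ⟨m - 1, by omega⟩
    exact ih h.2.2 (by omega)

lemma MemC1d.differentiableWithinAt_iterate {m : ℕ} {φ : ℝ → ℝ} (h : MemC1d m φ) {j : ℕ}
    (hj : j < m) {z : ℝ} (hz : z ∈ Set.Icc (0:ℝ) 1) :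
    DifferentiableWithinAt ℝ (dI^[j] φ) (Set.Icc (0:ℝ) 1) z := by
  induction j generalizing m φ with
  | zero =>
    obtain ⟨m, rfl⟩ : ∃ n, m = n + 1 := ⟨m - 1, by omega⟩
    exact h.2.1 z hz
  | succ j ih =>
    obtain ⟨m, rfl⟩ : ∃ n, m = n + 1 := ⟨m - 1, by omega⟩
    exact ih h.2.2 (by omega)

lemma dI_congr {φ ψ : ℝ → ℝ} (h : Set.EqOn φ ψ (Set.Icc (0:ℝ) 1)) :
    Set.EqOn (dI φ) (dI ψ) (Set.Icc (0:ℝ) 1) :=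
  fun _ hz => derivWithin_congr h (h hz)

lemma dI_iterate_congr {φ ψ : ℝ → ℝ} (h : Set.EqOn φ ψ (Set.Icc (0:ℝ) 1)) (j : ℕ) :
    Set.EqOn (dI^[j] φ) (dI^[j] ψ) (Set.Icc (0:ℝ) 1) := by
  induction j generalizing φ ψ with
  | zero => exact h
  | succ j ih => exact ih (dI_congr h)

lemma MemC1d.congr {m : ℕ} {φ ψ : ℝ → ℝ} (hφ : MemC1d m φ)
    (h : Set.EqOn φ ψ (Set.Icc (0:ℝ) 1)) : MemC1d m ψ := by
  induction m generalizing φ ψ with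
  | zero => exact ContinuousOn.congr hφ h.symm
  | succ m ih =>
    exact ⟨hφ.1.congr h.symm, fun z hz => (hφ.2.1 z hz).congr (fun _ hy => (h hy).symm) (h hz).symm,
      ih hφ.2.2 (dI_congr h)⟩

lemma dI_sub {φ ψ : ℝ → ℝ}
    (hφ : ∀ z ∈ Set.Icc (0:ℝ) 1, DifferentiableWithinAt ℝ φ (Set.Icc (0:ℝ) 1) z)
    (hψ : ∀ z ∈ Set.Icc (0:ℝ) 1, DifferentiableWithinAt ℝ ψ (Set.Icc (0:ℝ) 1) z) :
    Set.EqOn (dI (φ - ψ)) (dI φ - dI ψ) (Set.Icc (0:ℝ) 1) :=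
  fun z hz => derivWithin_sub (hφ z hz) (hψ z hz)

lemma MemC1d.sub {m : ℕ} {φ ψ : ℝ → ℝ} (hφ : MemC1d m φ) (hψ : MemC1d m ψ) :
    MemC1d m (φ - ψ) := by
  induction m generalizing φ ψ with
  | zero => exact ContinuousOn.sub hφ hψ
  | succ m ih =>
    exact ⟨hφ.1.sub hψ.1, fun z hz => (hφ.2.1 z hz).sub (hψ.2.1 z hz),
      (ih hφ.2.2 hψ.2.2).congr (dI_sub hφ.2.1 hψ.2.1).symm⟩

lemma dI_iterate_sub {m : ℕ} {φ ψ : ℝ → ℝ} (hφ : MemC1d m φ) (hψ : MemC1d m ψ) {j : ℕ}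
    (hj : j ≤ m) : Set.EqOn (dI^[j] (φ - ψ)) (dI^[j] φ - dI^[j] ψ) (Set.Icc (0:ℝ) 1) := by
  induction j generalizing m φ ψ with
  | zero => exact fun _ _ => rfl
  | succ j ih =>
    obtain ⟨m, rfl⟩ : ∃ n, m = n + 1 := ⟨m - 1, by omega⟩
    exact (dI_iterate_congr (dI_sub hφ.2.1 hψ.2.1) j).trans (ih hφ.2.2 hψ.2.2 (by omega))

lemma MemC1d.abs_le_C1dNorm {m : ℕ} {φ : ℝ → ℝ} (h : MemC1d m φ) {j : ℕ} (hj : j ≤ m) {z : ℝ}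
    (hz : z ∈ Set.Icc (0:ℝ) 1) : |dI^[j] φ z| ≤ C1dNorm m φ := by
  have hb : BddAbove (Set.range fun z : Set.Icc (0:ℝ) 1 => |dI^[j] φ z.1|) := by
    obtain ⟨C, hC⟩ := isCompact_Icc.exists_bound_of_continuousOn (h.continuousOn_iterate hj)
    exact ⟨C, by rintro _ ⟨z, rfl⟩; exact hC z.1 z.2⟩
  refine (le_ciSup hb ⟨z, hz⟩).trans ?_
  exact le_ciSup (f := fun k : Fin (m + 1) => ⨆ z : Set.Icc (0:ℝ) 1, |dI^[(k : ℕ)] φ z.1|)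
    (Set.finite_range _).bddAbove ⟨j, by omega⟩

lemma C1dNorm_le {m : ℕ} {φ : ℝ → ℝ} {C : ℝ}
    (h : ∀ j ≤ m, ∀ z ∈ Set.Icc (0:ℝ) 1, |dI^[j] φ z| ≤ C) : C1dNorm m φ ≤ C := by
  have : Nonempty (Set.Icc (0:ℝ) 1) := ⟨⟨0, by simp⟩⟩
  exact ciSup_le fun k => ciSup_le fun z => h k (by omega) z z.2

/-! ### Sections of `C^m` functions on the cube -/

lemma MemCm.continuousOn {d m : ℕ} {f : (Fin d → ℝ) → ℝ} (h : MemCm d m f) :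
    ContinuousOn f (cube d) := by
  cases m with
  | zero => exact h
  | succ m => exact h.1

lemma MemCm.continuousOn_iterate {d m : ℕ} {f : (Fin d → ℝ) → ℝ} (h : MemCm d m f) (i : Fin d)
    {j : ℕ} (hj : j ≤ m) : ContinuousOn ((pd d i)^[j] f) (cube d) := by
  induction j generalizing m f with
  | zero => exact h.continuousOn
  | succ j ih =>
    obtain ⟨m, rfl⟩ : ∃ n, m = n + 1 := ⟨m - 1, by omega⟩
    exact ih (h.2 i).2 (by omega)

lemma dI_section {d : ℕ} (f : (Fin d → ℝ) → ℝ) (x : Fin d → ℝ) (i : Fin d) :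
    dI (fun t => f (Function.update x i t)) = fun t => pd d i f (Function.update x i t) := by
  funext t
  simp [dI, pd]

lemma dI_iterate_section {d : ℕ} (f : (Fin d → ℝ) → ℝ) (x : Fin d → ℝ) (i : Fin d) (j : ℕ) :
    dI^[j] (fun t => f (Function.update x i t)) =
      fun t => (pd d i)^[j] f (Function.update x i t) := by
  induction j generalizing f with
  | zero => rfl
  | succ j ih => rw [Function.iterate_succ_apply, dI_section, ih, Function.iterate_succ_apply]

lemma continuousOn_section {d : ℕ} {f : (Fin d → ℝ) → ℝ} (h : ContinuousOn f (cube d))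
    {x : Fin d → ℝ} (hx : x ∈ cube d) (i : Fin d) :
    ContinuousOn (fun t => f (Function.update x i t)) (Set.Icc (0:ℝ) 1) :=
  h.comp ((continuous_const (y := x)).update i continuous_id).continuousOn
    fun _ ht => update_mem_cube hx i ht

lemma MemCm.memC1d_section {d m : ℕ} {f : (Fin d → ℝ) → ℝ} (h : MemCm d m f) {x : Fin d → ℝ}
    (hx : x ∈ cube d) (i : Fin d) : MemC1d m (fun t => f (Function.update x i t)) := by
  induction m generalizing f with
  | zero => exact continuousOn_section h hx i
  | succ m ih =>
    refine ⟨continuousOn_section h.1 hx i, fun z hz => ?_, ?_⟩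
    · simpa using (h.2 i).1 _ (update_mem_cube hx i hz)
    · rw [dI_section]
      exact ih (h.2 i).2

/-! ### Measures concentrated on the interval or the cube -/

lemma integral_congr_of_eqOn_Icc {μ : Measure ℝ} (hμ : μ (Set.Icc (0:ℝ) 1)ᶜ = 0) {φ ψ : ℝ → ℝ}
    (h : Set.EqOn φ ψ (Set.Icc (0:ℝ) 1)) : ∫ y, φ y ∂μ = ∫ y, ψ y ∂μ := by
  refine integral_congr_ae ?_
  have : ∀ᵐ y ∂μ, y ∈ Set.Icc (0:ℝ) 1 := hμ
  filter_upwards [this] with y hy using h hy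

lemma integrable_of_continuousOn_Icc {μ : Measure ℝ} [IsFiniteMeasure μ]
    (hμ : μ (Set.Icc (0:ℝ) 1)ᶜ = 0) {φ : ℝ → ℝ} (h : ContinuousOn φ (Set.Icc (0:ℝ) 1)) :
    Integrable φ μ := by
  have h1 : ∀ᵐ y ∂μ, y ∈ Set.Icc (0:ℝ) 1 := hμ
  have h2 : IntegrableOn φ (Set.Icc (0:ℝ) 1) μ := h.integrableOn_compact isCompact_Icc
  rwa [IntegrableOn, Measure.restrict_eq_self_of_ae_mem h1] at h2

lemma ae_mem_cube_pi {d : ℕ} (μ : Fin d → Measure ℝ) [∀ k, IsProbabilityMeasure (μ k)]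
    (hμ : ∀ k, μ k (Set.Icc (0:ℝ) 1)ᶜ = 0) : ∀ᵐ y ∂Measure.pi μ, y ∈ cube d := by
  have : ∀ k, ∀ᵐ y ∂Measure.pi μ, y k ∈ Set.Icc (0:ℝ) 1 := fun k =>
    (Measure.quasiMeasurePreserving_eval (μ := μ) k).ae (hμ k)
  filter_upwards [ae_all_iff.2 this] with y hy k _ using hy k

/-- Resampling one coordinate of a product measure. -/
lemma pi_update_eq_map {d : ℕ} (μ : Fin d → Measure ℝ) [∀ k, IsProbabilityMeasure (μ k)]
    (i : Fin d) (ν : Measure ℝ) [IsProbabilityMeasure ν] :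
    Measure.pi (Function.update μ i ν) =
      ((Measure.pi μ).prod ν).map (fun q => Function.update q.1 i q.2) := by
  have hi : ∀ k, IsProbabilityMeasure (Function.update μ i ν k) := by
    intro k
    rcases eq_or_ne k i with rfl | hk
    · simpa
    · simpa [hk] using inferInstanceAs (IsProbabilityMeasure (μ k))
  have hmeas : Measurable (fun q : (Fin d → ℝ) × ℝ => Function.update q.1 i q.2) :=
    (continuous_fst.update i continuous_snd).measurable
  refine Measure.pi_eq fun s hs => ?_
  rw [Measure.map_apply hmeas (MeasurableSet.univ_pi hs)]
  have hpre : (fun q : (Fin d → ℝ) × ℝ => Function.update q.1 i q.2) ⁻¹' (Set.univ.pi s) =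
      (Set.univ.pi (Function.update s i Set.univ)) ×ˢ s i := by
    ext q
    simp only [Set.mem_preimage, Set.mem_pi, Set.mem_univ, true_implies, Set.mem_prod]
    constructor
    · intro h
      refine ⟨fun k => ?_, by simpa using h i⟩
      rcases eq_or_ne k i with rfl | hk
      · simp
      · simpa [hk] using h k
    · rintro ⟨h, h'⟩ k
      rcases eq_or_ne k i with rfl | hk
      · simpa using h'
      · simpa [hk] using h k
  rw [hpre, Measure.prod_prod, Measure.pi_pi,
    ← Finset.mul_prod_erase _ _ (Finset.mem_univ i),
    ← Finset.mul_prod_erase _ _ (Finset.mem_univ i)]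
  simp only [Function.update_self, measure_univ, one_mul]
  rw [mul_comm]
  congr 1
  refine Finset.prod_congr rfl fun k hk => ?_
  simp [Finset.ne_of_mem_erase hk]

lemma integral_pi_update {d : ℕ} (μ : Fin d → Measure ℝ) [∀ k, IsProbabilityMeasure (μ k)]
    (i : Fin d) (ν : Measure ℝ) [IsProbabilityMeasure ν] {g : (Fin d → ℝ) → ℝ}
    (hg : Continuous g) {C : ℝ} (hC : ∀ y, |g y| ≤ C) :
    ∫ y, g y ∂Measure.pi (Function.update μ i ν) =
      ∫ y, ∫ s, g (Function.update y i s) ∂ν ∂Measure.pi μ := by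
  have hcont : Continuous (fun q : (Fin d → ℝ) × ℝ => Function.update q.1 i q.2) :=
    continuous_fst.update i continuous_snd
  rw [pi_update_eq_map, integral_map hcont.measurable.aemeasurable hg.aestronglyMeasurable,
    integral_prod]
  exact Integrable.of_bound (hg.comp hcont).aestronglyMeasurable C (.of_forall fun q => hC _)

/-! ### Differentiation under the integral sign on the interval -/

lemma hasDerivWithinAt_Icc_integral {Y : Type*} [MeasurableSpace Y] {μ : Measure Y}
    [IsFiniteMeasure μ] {h h' : Y → ℝ → ℝ} {C : ℝ}
    (hint : ∀ t ∈ Set.Icc (0:ℝ) 1, Integrable (fun y => h y t) μ)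
    (hd : ∀ y, ∀ t ∈ Set.Icc (0:ℝ) 1, HasDerivWithinAt (h y) (h' y t) (Set.Icc (0:ℝ) 1) t)
    (hC : ∀ y, ∀ t ∈ Set.Icc (0:ℝ) 1, |h' y t| ≤ C) {t : ℝ} (ht : t ∈ Set.Icc (0:ℝ) 1) :
    HasDerivWithinAt (fun t => ∫ y, h y t ∂μ) (∫ y, h' y t ∂μ) (Set.Icc (0:ℝ) 1) t := by
  rw [hasDerivWithinAt_iff_tendsto_slope]
  have hmem : ∀ᶠ s in nhdsWithin t (Set.Icc (0:ℝ) 1 \ {t}), s ∈ Set.Icc (0:ℝ) 1 \ {t} :=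
    self_mem_nhdsWithin
  have hlim : Tendsto (fun s => ∫ y, slope (h y) t s ∂μ)
      (nhdsWithin t (Set.Icc (0:ℝ) 1 \ {t})) (nhds (∫ y, h' y t ∂μ)) := by
    refine tendsto_integral_filter_of_dominated_convergence (fun _ => C) ?_ ?_
      (integrable_const C) ?_
    · filter_upwards [hmem] with s hs
      simp only [slope_def_field]
      exact (((hint s hs.1).sub (hint t ht)).div_const _).aestronglyMeasurable
    · filter_upwards [hmem] with s hs
      refine .of_forall fun y => ?_
      have := (convex_Icc (0:ℝ) 1).norm_image_sub_le_of_norm_hasDerivWithin_le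
        (fun z hz => hd y z hz) (fun z hz => hC y z hz) ht hs.1
      have hpos : 0 < |s - t| := abs_pos.2 (sub_ne_zero.2 hs.2)
      rw [slope_def_field, Real.norm_eq_abs, abs_div, div_le_iff₀ hpos]
      exact this
    · exact .of_forall fun y => hasDerivWithinAt_iff_tendsto_slope.1 (hd y t ht)
  refine hlim.congr' ?_
  filter_upwards [hmem] with s hs
  simp only [slope_def_field]
  rw [integral_div, integral_sub (hint s hs.1) (hint t ht)]

/-! ### Product kernels -/

lemma pd_congr {d : ℕ} {g g' : (Fin d → ℝ) → ℝ} (h : Set.EqOn g g' (cube d)) (i : Fin d) :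
    Set.EqOn (pd d i g) (pd d i g') (cube d) := by
  intro x hx
  exact derivWithin_congr (fun t ht => h (update_mem_cube hx i ht))
    (h (update_mem_cube hx i (hx i trivial)))

lemma PEC.congr {d : ℕ} {L : List (Fin d)} {g g' : (Fin d → ℝ) → ℝ} (hg : PEC d L g)
    (h : Set.EqOn g g' (cube d)) : PEC d L g' := by
  induction L generalizing g g' with
  | nil => exact ContinuousOn.congr hg h.symm
  | cons i L ih =>
    refine ⟨fun x hx => (hg.1 x hx).congr (fun t ht => (h (update_mem_cube hx i ht)).symm)
      (h (update_mem_cube hx i (hx i trivial))).symm, ih hg.2 (pd_congr h i)⟩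

/-- A product of Feller kernels is jointly continuous when tested against functions which may
also depend on one coordinate of the starting point. -/
lemma continuousOn_integral_pi {d : ℕ} {p : Fin d → ℝ → Measure ℝ}
    [∀ k z, IsProbabilityMeasure (p k z)]
    (hp : ∀ k, ∀ φ : ℝ → ℝ, Continuous φ →
      ContinuousOn (fun z => ∫ y, φ y ∂p k z) (Set.Icc (0:ℝ) 1))
    {w : (Fin d → ℝ) → ℝ → ℝ} (hw : Continuous fun q : (Fin d → ℝ) × ℝ => w q.1 q.2) {C : ℝ}
    (hC : ∀ y t, |w y t| ≤ C) (i : Fin d) :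
    ContinuousOn (fun x => ∫ y, w y (x i) ∂Measure.pi (fun k => p k (x k))) (cube d) := by
  let P : Fin d → ℝ → ProbabilityMeasure ℝ := fun k z => ⟨p k z, inferInstance⟩
  have hP : ∀ k, ContinuousOn (P k) (Set.Icc (0:ℝ) 1) := fun k z hz =>
    ProbabilityMeasure.tendsto_iff_forall_integral_tendsto.2 fun φ => hp k φ φ.continuous z hz
  have hPi : ContinuousOn (fun x : Fin d → ℝ => (ProbabilityMeasure.pi fun k => P k (x k)).prod
      (diracProba (x i))) (cube d) := by
    refine ProbabilityMeasure.continuous_prod.comp_continuousOn (ContinuousOn.prodMk ?_ ?_)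
    · refine ProbabilityMeasure.continuous_pi.comp_continuousOn (continuousOn_pi.2 fun k => ?_)
      exact (hP k).comp (continuous_apply k).continuousOn fun x hx => hx k trivial
    · exact (continuous_diracProba.comp (continuous_apply i)).continuousOn
  let W : BoundedContinuousFunction ((Fin d → ℝ) × ℝ) ℝ :=
    BoundedContinuousFunction.ofNormedAddCommGroup _ hw C fun q => hC _ _
  intro x hx
  have := ProbabilityMeasure.tendsto_iff_forall_integral_tendsto.1 (hPi x hx) W
  have key : ∀ x : Fin d → ℝ, ∫ q, W q ∂((ProbabilityMeasure.pi fun k => P k (x k)).prod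
      (diracProba (x i)) : Measure ((Fin d → ℝ) × ℝ)) =
      ∫ y, w y (x i) ∂Measure.pi (fun k => p k (x k)) := by
    intro x
    rw [ProbabilityMeasure.toMeasure_prod, integral_prod]
    · simp only [diracProba, ProbabilityMeasure.coe_mk, integral_dirac]
      rfl
    · exact W.integrable _
  simpa only [ContinuousWithinAt, key] using this

/-- If the derivatives `V j` of `V 0` in the last variable are continuous and do not depend on the
`i`-th coordinate of the first one, then integrating `V 0` against a product of Feller kernels
yields a function with continuous pure derivatives in the `i`-th coordinate. -/
lemma PEC_integral_pi {d : ℕ} {p : Fin d → ℝ → Measure ℝ} [∀ k z, IsProbabilityMeasure (p k z)]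
    (hp : ∀ k, ∀ φ : ℝ → ℝ, Continuous φ →
      ContinuousOn (fun z => ∫ y, φ y ∂p k z) (Set.Icc (0:ℝ) 1))
    (i : Fin d) {m : ℕ} {V : ℕ → (Fin d → ℝ) → ℝ → ℝ}
    (hV : ∀ j ≤ m, Continuous fun q : (Fin d → ℝ) × ℝ => V j q.1 (clamp q.2))
    (hC : ∀ j ≤ m, ∃ C, ∀ y, ∀ t ∈ Set.Icc (0:ℝ) 1, |V j y t| ≤ C)
    (hupd : ∀ j y s, V j (Function.update y i s) = V j y)
    (hd : ∀ j < m, ∀ y, ∀ t ∈ Set.Icc (0:ℝ) 1,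
      HasDerivWithinAt (V j y) (V (j + 1) y t) (Set.Icc (0:ℝ) 1) t)
    {n j : ℕ} (hnj : j + n = m) :
    PEC d (List.replicate n i)
      (fun x => ∫ y, V j y (x i) ∂Measure.pi (fun k => p k (x k))) := by
  have hVt : ∀ j ≤ m, ∀ t ∈ Set.Icc (0:ℝ) 1, Continuous fun y => V j y t := fun j hj t ht => by
    have := (hV j hj).comp (continuous_id.prodMk (continuous_const (y := t)))
    simpa [Function.comp_def, clamp_of_mem ht] using this
  induction n generalizing j with
  | zero =>
    obtain ⟨C, hC⟩ := hC j (by omega)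
    have := continuousOn_integral_pi hp (hV j (by omega)) (fun y t => hC y _ (clamp_mem t)) i
    refine this.congr fun x hx => ?_
    simp only [clamp_of_mem (hx i trivial)]
  | succ n ih =>
    obtain ⟨C, hCj⟩ := hC j (by omega)
    obtain ⟨C', hCj'⟩ := hC (j + 1) (by omega)
    have hderiv : ∀ x ∈ cube d, HasDerivWithinAt
        (fun t => ∫ y, V j y (Function.update x i t i)
          ∂Measure.pi (fun k => p k (Function.update x i t k)))
        (∫ y, V (j + 1) y (x i) ∂Measure.pi (fun k => p k (x k))) (Set.Icc (0:ℝ) 1) (x i) := by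
      intro x hx
      have heq : ∀ t ∈ Set.Icc (0:ℝ) 1, ∫ y, V j y (Function.update x i t i)
          ∂Measure.pi (fun k => p k (Function.update x i t k)) =
          ∫ y, V j y t ∂Measure.pi (fun k => p k (x k)) := by
        intro t ht
        have hmu : (fun k => p k (Function.update x i t k)) =
            Function.update (fun k => p k (x k)) i (p i t) := by
          funext k
          rcases eq_or_ne k i with rfl | hk
          · simp
          · simp [hk]
        rw [hmu, Function.update_self, integral_pi_update _ i _ (hVt j (by omega) t ht)
          (fun y => hCj y t ht)]
        simp [hupd]
      refine HasDerivWithinAt.congr ?_ heq (heq _ (hx i trivial))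
      refine hasDerivWithinAt_Icc_integral (fun t ht => ?_) (hd j (by omega)) hCj' (hx i trivial)
      exact Integrable.of_bound (hVt j (by omega) t ht).aestronglyMeasurable C
        (.of_forall fun y => hCj y t ht)
    refine ⟨fun x hx => (hderiv x hx).differentiableWithinAt,
      (ih (j := j + 1) (by omega)).congr fun x hx => ?_⟩
    exact ((hderiv x hx).derivWithin (uniqueDiffOn_Icc_zero_one _ (hx i trivial))).symm

/-- The `C^m` distance of nearby sections of a `C^m` function on the cube is small. -/
lemma MemCm.eventually_C1dNorm_section_le {d m : ℕ} {f : (Fin d → ℝ) → ℝ} (hf : MemCm d m f)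
    (i : Fin d) (y₀ : Fin d → ℝ) {ε : ℝ} (hε : 0 < ε) :
    ∀ᶠ y in nhds y₀, C1dNorm m ((fun t => f (Function.update (cubeClamp d y) i t)) -
      fun t => f (Function.update (cubeClamp d y₀) i t)) ≤ ε := by
  have hnear : ∀ k ∈ Set.Iic m, ∀ᶠ y in nhds y₀, ∀ t ∈ Set.Icc (0:ℝ) 1,
      |(pd d i)^[k] f (Function.update (cubeClamp d y) i t) -
        (pd d i)^[k] f (Function.update (cubeClamp d y₀) i t)| ≤ ε := by
    intro k hk
    have hcont : Continuous fun q : (Fin d → ℝ) × Set.Icc (0:ℝ) 1 =>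
        (pd d i)^[k] f (Function.update (cubeClamp d q.1) i q.2) :=
      (hf.continuousOn_iterate i hk).comp_continuous
        (((continuous_cubeClamp d).comp continuous_fst).update i
          (continuous_subtype_val.comp continuous_snd))
        fun q => update_mem_cube (cubeClamp_mem _) i q.2.2
    let F : C((Fin d → ℝ) × Set.Icc (0:ℝ) 1, ℝ) := ⟨_, hcont⟩
    filter_upwards [F.curry.continuous.tendsto y₀ (Metric.ball_mem_nhds _ hε)] with y hy t ht
    exact (ContinuousMap.dist_apply_le_dist (⟨t, ht⟩ : Set.Icc (0:ℝ) 1)).trans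
      (Metric.mem_ball.1 hy).le
  filter_upwards [(eventually_all_finite (Set.finite_Iic m)).2 hnear] with y hy
  refine C1dNorm_le fun k hk z hz => ?_
  rw [dI_iterate_sub (hf.memC1d_section (cubeClamp_mem y) i)
    (hf.memC1d_section (cubeClamp_mem y₀) i) hk hz, Pi.sub_apply, dI_iterate_section,
    dI_iterate_section]
  exact hy k hk z hz

/-- Continuity of pure derivatives for the product kernel: if each kernel `p^k` maps
`C^{m'}([0,1],ℝ)` into itself with operator norm at most `c` for all `m' ≤ m`, then for
`f ∈ C^m([0,1]^d,ℝ)` and every `i` the `m`-th partial derivative in the `i`-th coordinate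
of `x ↦ ∫ f(y) ⊗_{k=1}^d p^k(x_k,dy_k)` exists and is continuous on `[0,1]^d`. -/
theorem continuity_pure_derivatives_product_kernel
    (d : ℕ) (hd : 0 < d) (m : ℕ) (hm : m ≤ 3) (c : ℝ) (hc : 1 ≤ c)
    (p : Fin d → ℝ → Measure ℝ)
    [∀ k z, IsProbabilityMeasure (p k z)]
    (hmeas : ∀ k : Fin d, Measurable (p k))
    (hsupp : ∀ k : Fin d, ∀ z, p k z (Set.Icc (0:ℝ) 1)ᶜ = 0)
    (hp : ∀ k : Fin d, ∀ m' ≤ m, ∀ φ : ℝ → ℝ, MemC1d m' φ →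
      MemC1d m' (fun z => ∫ y, φ y ∂ p k z) ∧
      C1dNorm m' (fun z => ∫ y, φ y ∂ p k z) ≤ c * C1dNorm m' φ)
    (f : (Fin d → ℝ) → ℝ) (hf : MemCm d m f) (i : Fin d) :
    PEC d (List.replicate m i)
      (fun x : Fin d → ℝ => ∫ y, f y ∂ Measure.pi (fun k => p k (x k))) := by
  have hFeller : ∀ k, ∀ φ : ℝ → ℝ, Continuous φ →
      ContinuousOn (fun z => ∫ y, φ y ∂p k z) (Set.Icc (0:ℝ) 1) := fun k φ hφ =>
    (hp k 0 (Nat.zero_le m) φ hφ.continuousOn).1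
  let φ : (Fin d → ℝ) → ℝ → ℝ := fun y t => f (Function.update (cubeClamp d y) i t)
  have hφ : ∀ y, MemC1d m (φ y) := fun y => hf.memC1d_section (cubeClamp_mem y) i
  let T : (Fin d → ℝ) → ℝ → ℝ := fun y z => ∫ s, φ y s ∂p i z
  have hT : ∀ y, MemC1d m (T y) := fun y => (hp i m le_rfl _ (hφ y)).1
  let V : ℕ → (Fin d → ℝ) → ℝ → ℝ := fun j y => dI^[j] (T y)
  have hVsub : ∀ j ≤ m, ∀ y y₀, ∀ t ∈ Set.Icc (0:ℝ) 1,
      |V j y t - V j y₀ t| ≤ c * C1dNorm m (φ y - φ y₀) := by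
    intro j hj y y₀ t ht
    have hTsub : (fun z => ∫ s, (φ y - φ y₀) s ∂p i z) = T y - T y₀ := by
      funext z
      exact integral_sub (integrable_of_continuousOn_Icc (hsupp i z) (hφ y).continuousOn)
        (integrable_of_continuousOn_Icc (hsupp i z) (hφ y₀).continuousOn)
    have h := hp i m le_rfl _ ((hφ y).sub (hφ y₀))
    rw [hTsub] at h
    have h' := (h.1.abs_le_C1dNorm hj ht).trans h.2
    rwa [dI_iterate_sub (hT y) (hT y₀) hj ht] at h'
  have hVcont : ∀ j ≤ m, Continuous fun q : (Fin d → ℝ) × ℝ => V j q.1 (clamp q.2) := by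
    intro j hj
    let G : (Fin d → ℝ) → C(Set.Icc (0:ℝ) 1, ℝ) := fun y =>
      ⟨(Set.Icc (0:ℝ) 1).domRestrict (V j y), ((hT y).continuousOn_iterate hj).domRestrict⟩
    have hG : Continuous G := by
      refine continuous_iff_continuousAt.2 fun y₀ => Metric.tendsto_nhds.2 fun ε hε => ?_
      have hc0 : 0 < c := by linarith
      filter_upwards [hf.eventually_C1dNorm_section_le i y₀
        (show 0 < ε / (2 * c) by positivity)] with y hy
      refine lt_of_le_of_lt ?_ (half_lt_self hε)
      refine (ContinuousMap.dist_le (by positivity)).2 fun t => ?_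
      refine (hVsub j hj y y₀ t t.2).trans ((mul_le_mul_of_nonneg_left hy hc0.le).trans_eq ?_)
      field_simp
    exact (hG.comp continuous_fst).eval (continuous_projIcc.comp continuous_snd)
  have hVclamp : ∀ j y, V j (cubeClamp d y) = V j y := fun j y => by
    simp only [V, T, φ, cubeClamp_of_mem (cubeClamp_mem y)]
  have hVbound : ∀ j ≤ m, ∃ C, ∀ y, ∀ t ∈ Set.Icc (0:ℝ) 1, |V j y t| ≤ C := by
    intro j hj
    obtain ⟨C, hC⟩ := ((isCompact_cube d).prod isCompact_Icc).exists_bound_of_continuousOn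
      (hVcont j hj).continuousOn
    refine ⟨C, fun y t ht => ?_⟩
    simpa [hVclamp, clamp_of_mem ht] using hC (cubeClamp d y, t) ⟨cubeClamp_mem y, ht⟩
  have hVupd : ∀ j y s, V j (Function.update y i s) = V j y := fun j y s => by
    simp only [V, T, φ, cubeClamp_update, Function.update_idem]
  have hVderiv : ∀ j < m, ∀ y, ∀ t ∈ Set.Icc (0:ℝ) 1,
      HasDerivWithinAt (V j y) (V (j + 1) y t) (Set.Icc (0:ℝ) 1) t := by
    intro j hj y t ht
    have h := ((hT y).differentiableWithinAt_iterate hj ht).hasDerivWithinAt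
    simpa only [V, Function.iterate_succ_apply', dI] using h
  refine (PEC_integral_pi hFeller i hVcont hVbound hVupd hVderiv (Nat.zero_add m)).congr
    fun x hx => ?_
  have hfc : Continuous fun y => f (cubeClamp d y) :=
    hf.continuousOn.comp_continuous (continuous_cubeClamp d) cubeClamp_mem
  obtain ⟨C, hC⟩ := (isCompact_cube d).exists_bound_of_continuousOn hf.continuousOn
  have hclamp : ∫ y, f y ∂Measure.pi (fun k => p k (x k)) =
      ∫ y, f (cubeClamp d y) ∂Measure.pi (fun k => p k (x k)) := by
    refine integral_congr_ae ?_
    filter_upwards [ae_mem_cube_pi (fun k => p k (x k)) fun k => hsupp k (x k)] with y hy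
    rw [cubeClamp_of_mem hy]
  have hresample := integral_pi_update (fun k => p k (x k)) i (p i (x i)) hfc
    fun y => hC _ (cubeClamp_mem y)
  rw [Function.update_eq_self i fun k => p k (x k)] at hresample
  simp only [hclamp, hresample]
  refine integral_congr_ae (.of_forall fun y => integral_congr_of_eqOn_Icc (hsupp i (x i)) ?_)
  intro s hs
  simp only [φ, cubeClamp_update, clamp_of_mem hs]

end
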